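/- Let f(y₁, y₂) = max(y₂ − y₁², 0) and let (P₁f)(y₂) = ∫_ℝ f(y₁, y₂) ρ(y₁) dy₁. Then (P₁f)(y₂) = 0 for y₂ ≤ 0, (P₁f)(y₂) = ∫_{−√y₂}^{√y₂} (y₂ − y₁²) ρ(y₁) dy₁ for y₂ > 0, and (P₁f)(y₂)/y₂^{3/2} → (4/3)ρ(0) as y₂ → 0⁺. Thus the kink integrand leads to a y₂^{3/2}-type singularity of P₁f at y₂ = 0, weaker than the square-root singularity arising from the corresponding jump integrand ind(y₂ − y₁²). -/

import Mathlib

open Filter Topology Set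

/-- The standard normal density. -/
noncomputable def ρ (y : ℝ) : ℝ := Real.exp (-y ^ 2 / 2) / Real.sqrt (2 * Real.pi)

theorem rho_cont : Continuous ρ := by
  unfold ρ
  fun_prop

theorem rho_nonneg (t : ℝ) : 0 ≤ ρ t := by
  unfold ρ
  positivity

theorem P_pos (y : ℝ) (hy : 0 < y) :
    (∫ t : ℝ, max (y - t ^ 2) 0 * ρ t) =
        ∫ t in (-Real.sqrt y)..(Real.sqrt y), (y - t ^ 2) * ρ t := by
  have hs : 0 ≤ Real.sqrt y := Real.sqrt_nonneg y
  have hsq : Real.sqrt y ^ 2 = y := Real.sq_sqrt hy.le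
  rw [intervalIntegral.integral_of_le (by linarith)]
  rw [← MeasureTheory.setIntegral_eq_integral_of_forall_compl_eq_zero
    (s := Ioc (-Real.sqrt y) (Real.sqrt y))]
  · apply MeasureTheory.setIntegral_congr_fun measurableSet_Ioc
    intro t ht
    have h : t ^ 2 ≤ y := by
      rw [← hsq]; exact sq_le_sq' ht.1.le ht.2
    simp only
    rw [max_eq_left (by linarith)]
  · intro t ht
    have h : y ≤ t ^ 2 := by
      by_contra hc
      push Not at hc
      have := abs_lt_of_sq_lt_sq (a := t) (b := Real.sqrt y) (by rw [hsq]; exact hc) hs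
      exact ht ⟨(abs_lt.1 this).1, (abs_lt.1 this).2.le⟩
    rw [max_eq_right (by linarith), zero_mul]

theorem poly_int (y : ℝ) (hy : 0 < y) (c : ℝ) :
    (∫ t in (-Real.sqrt y)..(Real.sqrt y), (y - t ^ 2) * c) = 4 / 3 * c * Real.sqrt y ^ 3 := by
  have hsq : Real.sqrt y ^ 2 = y := Real.sq_sqrt hy.le
  rw [intervalIntegral.integral_mul_const, intervalIntegral.integral_sub (by simp)
    (by apply Continuous.intervalIntegrable; fun_prop)]
  simp only [intervalIntegral.integral_const, integral_pow, smul_eq_mul]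
  have : y * Real.sqrt y = Real.sqrt y ^ 3 := by
    nth_rewrite 1 [← hsq]; ring
  push_cast
  linear_combination (2 * c) * this

theorem rho_bounds (y t : ℝ) (h : t ^ 2 ≤ y) : Real.exp (-y / 2) * ρ 0 ≤ ρ t ∧ ρ t ≤ ρ 0 := by
  unfold ρ
  constructor
  · rw [← mul_div_assoc, ← Real.exp_add]
    gcongr
    linarith
  · refine div_le_div_of_nonneg_right (Real.exp_le_exp.2 ?_) (Real.sqrt_nonneg _)
    nlinarith [sq_nonneg t]

/-- **Kink version of Example 1 of the paper.**  For `f(y₁,y₂) = max(y₂ − y₁², 0)` and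
`(P₁ f)(y₂) = ∫_ℝ f(y₁,y₂) ρ(y₁) dy₁`, one has `(P₁ f)(y₂) = 0` for `y₂ ≤ 0`,
`(P₁ f)(y₂) = ∫_{−√y₂}^{√y₂} (y₂ − y₁²) ρ(y₁) dy₁` for `y₂ > 0`, and
`(P₁ f)(y₂)/y₂^{3/2} → (4/3) ρ(0)` as `y₂ → 0⁺`: a `y₂^{3/2}`-type singularity at `0`,
weaker than the square-root singularity of the corresponding jump integrand. -/
theorem preintegration_parabola_kink :
    (∀ y₂ : ℝ, y₂ ≤ 0 → (∫ y₁ : ℝ, max (y₂ - y₁ ^ 2) 0 * ρ y₁) = 0) ∧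
    (∀ y₂ : ℝ, 0 < y₂ →
      (∫ y₁ : ℝ, max (y₂ - y₁ ^ 2) 0 * ρ y₁) =
        ∫ y₁ in (-Real.sqrt y₂)..(Real.sqrt y₂), (y₂ - y₁ ^ 2) * ρ y₁) ∧
    Tendsto (fun y₂ : ℝ => (∫ y₁ : ℝ, max (y₂ - y₁ ^ 2) 0 * ρ y₁) / y₂ ^ ((3 : ℝ) / 2))
      (𝓝[>] 0) (𝓝 (4 / 3 * ρ 0)) := by
  refine ⟨?_, P_pos, ?_⟩
  · intro y hy
    have : ∀ t : ℝ, max (y - t ^ 2) 0 * ρ t = 0 := fun t => by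
      rw [max_eq_right (by nlinarith [sq_nonneg t]), zero_mul]
    simp [this]
  have key : ∀ y : ℝ, 0 < y →
      4 / 3 * (Real.exp (-y / 2) * ρ 0) ≤
        (∫ t : ℝ, max (y - t ^ 2) 0 * ρ t) / y ^ ((3 : ℝ) / 2) ∧
      (∫ t : ℝ, max (y - t ^ 2) 0 * ρ t) / y ^ ((3 : ℝ) / 2) ≤ 4 / 3 * ρ 0 := by
    intro y hy
    have hs : 0 < Real.sqrt y := Real.sqrt_pos.2 hy
    have hsq : Real.sqrt y ^ 2 = y := Real.sq_sqrt hy.le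
    have hp : y ^ ((3 : ℝ) / 2) = Real.sqrt y ^ 3 := by
      rw [Real.sqrt_eq_rpow, ← Real.rpow_natCast, ← Real.rpow_mul hy.le]
      norm_num
    have hc := rho_cont
    have hb : ∀ t ∈ Icc (-Real.sqrt y) (Real.sqrt y), t ^ 2 ≤ y := fun t ht => by
      rw [← hsq]; exact sq_le_sq' ht.1 ht.2
    rw [hp, P_pos y hy, le_div_iff₀ (by positivity), div_le_iff₀ (by positivity),
      ← poly_int y hy, ← poly_int y hy]
    constructor
    · apply intervalIntegral.integral_mono_on (by linarith)
      · apply Continuous.intervalIntegrable; fun_prop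
      · apply Continuous.intervalIntegrable; fun_prop
      · intro t ht
        exact mul_le_mul_of_nonneg_left (rho_bounds y t (hb t ht)).1 (by linarith [hb t ht])
    · apply intervalIntegral.integral_mono_on (by linarith)
      · apply Continuous.intervalIntegrable; fun_prop
      · apply Continuous.intervalIntegrable; fun_prop
      · intro t ht
        exact mul_le_mul_of_nonneg_left (rho_bounds y t (hb t ht)).2 (by linarith [hb t ht])
  have hl : Tendsto (fun y : ℝ => 4 / 3 * (Real.exp (-y / 2) * ρ 0)) (𝓝[>] 0)
      (𝓝 (4 / 3 * ρ 0)) := by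
    have hc : Continuous (fun y : ℝ => 4 / 3 * (Real.exp (-y / 2) * ρ 0)) := by fun_prop
    have := (hc.tendsto 0).mono_left (nhdsWithin_le_nhds (s := Ioi 0))
    simpa using this
  refine tendsto_of_tendsto_of_tendsto_of_le_of_le' hl tendsto_const_nhds ?_ ?_
  · filter_upwards [self_mem_nhdsWithin] with y hy using (key y hy).1
  · filter_upwards [self_mem_nhdsWithin] with y hy using (key y hy).2
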